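/- arXiv:1709.01752 — 6 statements merged into one kernel-verified Lean document; each statement's English description precedes it below -/
import Mathlib

section
/- Let A_1, …, A_p ∈ M_n(ℂ) be pairwise commuting matrices, each of which is a positive scalar multiple of a unitary matrix, satisfying ∑_{i=1}^p A_i^* A_i = I. Then there exist a unitary matrix U ∈ M_n(ℂ) and a correlation matrix C ∈ M_n(ℂ) such that for every ρ ∈ M_n(ℂ), ∑_{i=1}^p A_i ρ A_i^* = U (C ∘ (U^* ρ U)) U^*, where ∘ denotes the entrywise (Schur/Hadamard) product. -/
open scoped Matrix ComplexOrder

/-- If an orthogonal family of subspaces spans the space, then there is an orthonormal basis all of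
whose vectors lie in members of the family. -/
theorem OrthogonalFamily.exists_orthonormalBasis_forall_mem {𝕜 E n κ : Type*} [RCLike 𝕜]
    [NormedAddCommGroup E] [InnerProductSpace 𝕜 E] [Fintype n] (b₀ : OrthonormalBasis n 𝕜 E)
    {V : κ → Submodule 𝕜 E} (hV : OrthogonalFamily 𝕜 (fun a ↦ V a) fun a ↦ (V a).subtypeₗᵢ)
    (htop : ⨆ a, V a = ⊤) :
    ∃ v : OrthonormalBasis n 𝕜 E, ∀ k, ∃ a, v k ∈ V a := by
  classical
  have : FiniteDimensional 𝕜 E := b₀.toBasis.finiteDimensional_of_finite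
  have hint : DirectSum.IsInternal V :=
    hV.isInternal_iff.mpr (by rw [htop, Submodule.top_orthogonal_eq_bot])
  let w := fun a ↦ (stdOrthonormalBasis 𝕜 (V a)).toBasis
  have hw : ∀ a, Orthonormal 𝕜 (w a) := fun a ↦ by
    simp [w]
  have hb : Orthonormal 𝕜 (hint.collectedBasis w) := hint.collectedBasis_orthonormal hV hw
  let e := (hint.collectedBasis w).indexEquiv b₀.toBasis
  have he : Orthonormal 𝕜 ((hint.collectedBasis w).reindex e) := by
    rw [Module.Basis.coe_reindex]
    exact hb.comp _ e.symm.injective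
  refine ⟨((hint.collectedBasis w).reindex e).toOrthonormalBasis he, fun k ↦ ⟨(e.symm k).1, ?_⟩⟩
  rw [Module.Basis.coe_toOrthonormalBasis, Module.Basis.reindex_apply]
  exact hint.collectedBasis_mem w (e.symm k)

open scoped Function in
/-- A commuting family of symmetric operators on a finite-dimensional inner product space has an
orthonormal basis of joint eigenvectors. -/
theorem LinearMap.IsSymmetric.exists_orthonormalBasis_of_pairwise_commute {𝕜 E n ι : Type*}
    [RCLike 𝕜] [NormedAddCommGroup E] [InnerProductSpace 𝕜 E] [Fintype n]
    (b₀ : OrthonormalBasis n 𝕜 E) {T : ι → E →ₗ[𝕜] E} (hT : ∀ i, (T i).IsSymmetric)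
    (hcomm : Pairwise (Commute on T)) :
    ∃ (v : OrthonormalBasis n 𝕜 E) (d : ι → n → 𝕜), ∀ i k, T i (v k) = d i k • v k := by
  have : FiniteDimensional 𝕜 E := b₀.toBasis.finiteDimensional_of_finite
  obtain ⟨v, hv⟩ := (orthogonalFamily_iInf_eigenspaces hT).exists_orthonormalBasis_forall_mem b₀
    (iSup_iInf_eq_top_of_commute hT hcomm)
  choose χ hχ using hv
  exact ⟨v, fun i k ↦ χ k i, fun i k ↦
    Module.End.mem_eigenspace_iff.mp ((Submodule.mem_iInf _).mp (hχ k) i)⟩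

open scoped Function in
/-- A commuting family of Hermitian matrices is simultaneously unitarily diagonalizable. -/
theorem Matrix.exists_unitary_mul_diagonal_of_isHermitian {𝕜 n ι : Type*} [RCLike 𝕜] [Fintype n]
    [DecidableEq n] {B : ι → Matrix n n 𝕜} (hB : ∀ i, (B i).IsHermitian)
    (hcomm : Pairwise (Commute on B)) :
    ∃ U ∈ Matrix.unitaryGroup n 𝕜, ∃ d : ι → n → 𝕜, ∀ i, B i * U = U * Matrix.diagonal (d i) := by
  have hTc : Pairwise (Commute on fun i ↦ (B i).toEuclideanLin) := fun i j hij ↦ by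
    have h : B i * B j = B j * B i := hcomm hij
    ext1 x
    simp [Matrix.toLpLin_apply, h]
  obtain ⟨v, d, hd⟩ := LinearMap.IsSymmetric.exists_orthonormalBasis_of_pairwise_commute
    (EuclideanSpace.basisFun n 𝕜) (fun i ↦ Matrix.isSymmetric_toEuclideanLin_iff.mpr (hB i)) hTc
  refine ⟨(EuclideanSpace.basisFun n 𝕜).toBasis.toMatrix v.toBasis,
    (EuclideanSpace.basisFun n 𝕜).toMatrix_orthonormalBasis_mem_unitary v, d, fun i ↦ ?_⟩
  ext j k
  have hj := congr($(hd i k) j)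
  rw [Matrix.mul_diagonal]
  simpa [Matrix.toLpLin_apply, Matrix.mulVec, dotProduct, Matrix.mul_apply,
    Module.Basis.toMatrix_apply, mul_comm] using hj

open scoped Matrix.Norms.L2Operator ComplexStarModule in
/-- A commuting family of normal matrices is simultaneously unitarily diagonalizable. -/
theorem Matrix.exists_unitary_diagonal_of_isStarNormal {n ι : Type*} [Fintype n]
    [DecidableEq n] {A : ι → Matrix n n ℂ} (hA : ∀ i, IsStarNormal (A i))
    (hcomm : ∀ i j, Commute (A i) (A j)) :
    ∃ U ∈ Matrix.unitaryGroup n ℂ, ∃ d : ι → n → ℂ,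
      ∀ i, A i = U * Matrix.diagonal (d i) * Uᴴ := by
  have hstar : ∀ i j, Commute (A i) (star (A j)) := fun i j ↦
    (hA j).commute_star_right (hcomm i j)
  have hstar' : ∀ i j, Commute (star (A i)) (A j) := fun i j ↦ (hstar j i).symm
  have hss : ∀ i j, Commute (star (A i)) (star (A j)) := fun i j ↦ (hcomm i j).star_star
  have hadd : ∀ i {M : Matrix n n ℂ}, Commute (A i) M → Commute (star (A i)) M →
      Commute (ℜ (A i) : Matrix n n ℂ) M ∧ Commute (ℑ (A i) : Matrix n n ℂ) M := fun i M h h' ↦ by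
    rw [realPart_apply_coe, imaginaryPart_apply_coe]
    exact ⟨(h.add_left h').smul_left _, ((h.sub_left h').smul_left _).smul_left _⟩
  have hre : ∀ i j, Commute (A i) (ℜ (A j) : Matrix n n ℂ) ∧
      Commute (A i) (ℑ (A j) : Matrix n n ℂ) := fun i j ↦
    (hadd j (hcomm j i) (hstar' j i)).imp Commute.symm Commute.symm
  have hre' : ∀ i j, Commute (star (A i)) (ℜ (A j) : Matrix n n ℂ) ∧
      Commute (star (A i)) (ℑ (A j) : Matrix n n ℂ) := fun i j ↦
    (hadd j (hstar j i) (hss j i)).imp Commute.symm Commute.symm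
  let B : ι ⊕ ι → Matrix n n ℂ := Sum.elim (fun i ↦ ℜ (A i)) (fun i ↦ ℑ (A i))
  have hB : ∀ i, (B i).IsHermitian := by
    rintro (i | i)
    exacts [(ℜ (A i)).2, (ℑ (A i)).2]
  have hBcomm : ∀ i j, Commute (B i) (B j) := by
    rintro (i | i) (j | j)
    exacts [(hadd i (hre i j).1 (hre' i j).1).1, (hadd i (hre i j).2 (hre' i j).2).1,
      (hadd i (hre i j).1 (hre' i j).1).2, (hadd i (hre i j).2 (hre' i j).2).2]
  obtain ⟨U, hU, d, hd⟩ :=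
    Matrix.exists_unitary_mul_diagonal_of_isHermitian hB fun i j _ ↦ hBcomm i j
  refine ⟨U, hU, fun i ↦ d (.inl i) + Complex.I • d (.inr i), fun i ↦ ?_⟩
  have h : A i * U = U * Matrix.diagonal (d (.inl i) + Complex.I • d (.inr i)) := by
    have hsplit : Matrix.diagonal (d (.inl i) + Complex.I • d (.inr i)) =
        Matrix.diagonal (d (.inl i)) + Complex.I • Matrix.diagonal (d (.inr i)) := by
      rw [← Matrix.diagonal_smul, Matrix.diagonal_add]
      rfl
    rw [hsplit, mul_add, Matrix.mul_smul, ← hd, ← hd]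
    conv_lhs => rw [← realPart_add_I_smul_imaginaryPart (A i)]
    simp only [B, Sum.elim_inl, Sum.elim_inr, add_mul, Matrix.smul_mul]
  rw [← h, mul_assoc, ← Matrix.star_eq_conjTranspose, Matrix.mem_unitaryGroup_iff.mp hU, mul_one]

/-- A channel whose Kraus operators are pairwise commuting positive scalar
multiples of unitaries is, up to a unitary change of basis, a Schur product channel with a
correlation matrix. -/
theorem schur_form_of_commuting_unitary_kraus (n p : ℕ)
    (A : Fin p → Matrix (Fin n) (Fin n) ℂ)
    (hcomm : ∀ i j, Commute (A i) (A j))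
    (hscal : ∀ i, ∃ (c : ℝ) (V : Matrix (Fin n) (Fin n) ℂ),
      0 < c ∧ V ∈ Matrix.unitaryGroup (Fin n) ℂ ∧ A i = (c : ℂ) • V)
    (htp : ∑ i, (A i)ᴴ * A i = 1) :
    ∃ U ∈ Matrix.unitaryGroup (Fin n) ℂ, ∃ C : Matrix (Fin n) (Fin n) ℂ,
      C.PosSemidef ∧ (∀ k, C k k = 1) ∧
      ∀ ρ : Matrix (Fin n) (Fin n) ℂ,
        ∑ i, A i * ρ * (A i)ᴴ = U * (C ⊙ (Uᴴ * ρ * U)) * Uᴴ := by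
  have hnormal : ∀ i, IsStarNormal (A i) := fun i ↦ by
    obtain ⟨c, V, -, hV, h⟩ := hscal i
    rw [h, isStarNormal_iff, star_smul]
    have : Commute (star V) V := by
      rw [Commute, SemiconjBy, Matrix.mem_unitaryGroup_iff.mp hV,
        Matrix.mem_unitaryGroup_iff'.mp hV]
    exact (this.smul_left _).smul_right _
  obtain ⟨U, hU, d, hd⟩ := Matrix.exists_unitary_diagonal_of_isStarNormal hnormal hcomm
  have hUU : Uᴴ * U = 1 := Matrix.mem_unitaryGroup_iff'.mp hU
  have hUA : ∀ i, (A i)ᴴ = U * Matrix.diagonal (star (d i)) * Uᴴ := fun i ↦ by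
    simp [hd i, Matrix.conjTranspose_mul, Matrix.diagonal_conjTranspose, mul_assoc]
  have hdiag : ∑ i, Matrix.diagonal (star (d i)) * Matrix.diagonal (d i) = 1 := by
    have h : ∀ i, Uᴴ * ((A i)ᴴ * A i) * U =
        Matrix.diagonal (star (d i)) * Matrix.diagonal (d i) := fun i ↦ by
      rw [hUA, hd i]
      calc _ = (Uᴴ * U) * Matrix.diagonal (star (d i)) * (Uᴴ * U) * Matrix.diagonal (d i) *
            (Uᴴ * U) := by simp only [mul_assoc]
        _ = _ := by simp [hUU]
    simp_rw [← h, ← Finset.sum_mul, ← Finset.mul_sum, htp, mul_one, hUU]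
  refine ⟨U, hU, ∑ i, Matrix.vecMulVec (d i) (star (d i)),
    Matrix.posSemidef_sum _ fun i _ ↦ Matrix.posSemidef_vecMulVec_self_star _, fun k ↦ ?_,
    fun ρ ↦ ?_⟩
  · simpa [Matrix.sum_apply, Matrix.vecMulVec_apply, mul_comm] using congr($hdiag k k)
  · have h : (∑ i, Matrix.vecMulVec (d i) (star (d i))) ⊙ (Uᴴ * ρ * U) =
        ∑ i, Matrix.diagonal (d i) * (Uᴴ * ρ * U) * Matrix.diagonal (star (d i)) := by
      ext k l
      simp only [Matrix.hadamard_apply, Matrix.sum_apply, Matrix.vecMulVec_apply,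
        Matrix.mul_diagonal, Matrix.diagonal_mul, Finset.sum_mul]
      exact Finset.sum_congr rfl fun i _ ↦ by ring
    rw [h, Finset.mul_sum, Finset.sum_mul]
    refine Finset.sum_congr rfl fun i _ ↦ ?_
    rw [hUA, hd i]
    simp only [mul_assoc]
end

section
/- For every n ≥ 1 there exists a star-subalgebra 𝒜 of M_{2^n}(ℂ) that is star-isomorphic (as a complex star-algebra) to M_{2^{⌊n/2⌋}}(ℂ) and such that every a ∈ 𝒜 has constant diagonal: a_{ii} = Tr(a)/2^n for all i. Consequently, the channel Φ(X) = I ∘ X on M_{2^n}(ℂ) (Schur product with the identity matrix, i.e., the projection onto the diagonal) privatises 𝒜 to the unit. -/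
open scoped Matrix ComplexOrder
open scoped Kronecker

/-- The homomorphism `A ↦ Vᴴ (A ⊗ 1) V` attached to a coisometry `V`. -/
def amplificationConj {p L I : Type*} [Fintype p] [Fintype L] [Fintype I] [DecidableEq p]
    [DecidableEq L] (V : Matrix (p × L) I ℂ) (hV : V * Vᴴ = 1) :
    Matrix p p ℂ →⋆ₙₐ[ℂ] Matrix I I ℂ where
  toFun A := Vᴴ * (A ⊗ₖ (1 : Matrix L L ℂ)) * V
  map_smul' c A := by simp [Matrix.smul_kronecker]
  map_zero' := by simp
  map_add' A B := by simp [Matrix.add_kronecker, Matrix.mul_add, Matrix.add_mul]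
  map_mul' A B := by
    have h : (A * B) ⊗ₖ (1 : Matrix L L ℂ) = (A ⊗ₖ 1) * (V * Vᴴ) * (B ⊗ₖ 1) := by
      rw [hV, Matrix.mul_one, ← Matrix.mul_kronecker_mul, Matrix.mul_one]
    rw [h]
    simp only [Matrix.mul_assoc]
  map_star' A := by
    simp [Matrix.star_eq_conjTranspose, Matrix.conjTranspose_mul, Matrix.conjTranspose_kronecker,
      Matrix.mul_assoc]

theorem amplificationConj_injective {p L I : Type*} [Fintype p] [Fintype L] [Fintype I]
    [DecidableEq p] [DecidableEq L] [Nonempty L] (V : Matrix (p × L) I ℂ) (hV : V * Vᴴ = 1) :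
    Function.Injective (amplificationConj V hV) := by
  intro A B h
  change Vᴴ * (A ⊗ₖ (1 : Matrix L L ℂ)) * V = Vᴴ * (B ⊗ₖ (1 : Matrix L L ℂ)) * V at h
  have key : ∀ X : Matrix (p × L) (p × L) ℂ, V * (Vᴴ * X * V) * Vᴴ = X := fun X => by
    calc V * (Vᴴ * X * V) * Vᴴ = (V * Vᴴ) * X * (V * Vᴴ) := by simp only [Matrix.mul_assoc]
      _ = X := by rw [hV, Matrix.one_mul, Matrix.mul_one]
  have h' : A ⊗ₖ (1 : Matrix L L ℂ) = B ⊗ₖ 1 := by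
    rw [← key (A ⊗ₖ 1), h, key]
  obtain ⟨l⟩ := ‹Nonempty L›
  ext i j
  simpa [Matrix.kronecker_apply] using congrFun (congrFun h' (i, l)) (j, l)

/-- The coordinates of the maximally entangled basis of `ℂ^m ⊗ ℂ^m` (tensored with the standard
basis of an auxiliary factor): the basis vector with label `(a, b, t)` is
`m^(-1/2) ∑ⱼ χ(j a) |j⟩ ⊗ |j + b⟩ ⊗ |t⟩`. -/
noncomputable def entangledBasis {m : ℕ} [NeZero m] {R I : Type*} [DecidableEq R]
    (e : I ≃ ZMod m × ZMod m × R) : Matrix (Fin m × ZMod m × R) I ℂ :=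
  fun x i => if (e i).2 = (x.2.1 - ZMod.finEquiv m x.1, x.2.2) then
    ZMod.stdAddChar ((e i).1 * ZMod.finEquiv m x.1) / (Real.sqrt m : ℂ) else 0

theorem stdAddChar_div_sqrt_mul_star {m : ℕ} [NeZero m] (x y : ZMod m) :
    (ZMod.stdAddChar x / (Real.sqrt m : ℂ)) * star (ZMod.stdAddChar y / (Real.sqrt m : ℂ)) =
      ZMod.stdAddChar (x - y) / m := by
  have hs : (Real.sqrt m : ℂ) * (Real.sqrt m : ℂ) = m := by
    rw [← Complex.ofReal_mul, Real.mul_self_sqrt (Nat.cast_nonneg m), Complex.ofReal_natCast]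
  have hy : star (ZMod.stdAddChar y) = ZMod.stdAddChar (-y) :=
    (AddChar.map_neg_eq_conj _ y).symm
  rw [star_div₀, hy, sub_eq_add_neg, AddChar.map_add_eq_mul, div_mul_div_comm]
  congr 1
  rw [← hs]
  simp

theorem entangledBasis_mul_conjTranspose {m : ℕ} [NeZero m] {R I : Type*} [DecidableEq R]
    [Fintype R] [Fintype I] (e : I ≃ ZMod m × ZMod m × R) :
    entangledBasis e * (entangledBasis e)ᴴ = 1 := by
  have hm : (m : ℂ) ≠ 0 := Nat.cast_ne_zero.2 (NeZero.ne m)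
  ext ⟨j, l, s⟩ ⟨j', l', s'⟩
  rw [Matrix.mul_apply, ← e.symm.sum_comp, Fintype.sum_prod_type_right]
  simp only [Matrix.conjTranspose_apply, entangledBasis, Equiv.apply_symm_apply]
  rw [Finset.sum_eq_single (l - ZMod.finEquiv m j, s)]
  · by_cases h : (l - ZMod.finEquiv m j, s) = (l' - ZMod.finEquiv m j', s')
    · simp only [h, if_true, stdAddChar_div_sqrt_mul_star, ← mul_sub]
      rw [← Finset.sum_div, AddChar.sum_mulShift _ (ZMod.isPrimitive_stdAddChar m)]
      by_cases hj : j = j'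
      · subst hj
        obtain ⟨rfl, rfl⟩ : l = l' ∧ s = s' := by simpa using h
        simp [hm]
      · have : ZMod.finEquiv m j - ZMod.finEquiv m j' ≠ 0 := by
          simpa [sub_eq_zero] using hj
        simp [this, hj]
    · have : (j, l, s) ≠ (j', l', s') := by
        rintro h'
        simp only [Prod.mk.injEq] at h'
        obtain ⟨rfl, rfl, rfl⟩ := h'
        exact h rfl
      simp [h, Matrix.one_apply_ne this]
  · intro b _ hb
    simp [hb]
  · simp

theorem amplificationConj_entangledBasis_diag {m : ℕ} [NeZero m] {R I : Type*} [DecidableEq R]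
    [Fintype R] [Fintype I] (e : I ≃ ZMod m × ZMod m × R) (A : Matrix (Fin m) (Fin m) ℂ) (i : I) :
    amplificationConj (entangledBasis e) (entangledBasis_mul_conjTranspose e) A i i =
      A.trace / m := by
  change ((entangledBasis e)ᴴ * (A ⊗ₖ (1 : Matrix (ZMod m × R) (ZMod m × R) ℂ)) *
    entangledBasis e) i i = _
  rw [Matrix.mul_assoc, Matrix.mul_apply, Fintype.sum_prod_type, Matrix.trace, Finset.sum_div]
  refine Finset.sum_congr rfl fun j _ => ?_
  have hl : ∀ l : ZMod m × R, (e i).2 = (l.1 - ZMod.finEquiv m j, l.2) ↔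
      l = ((e i).2.1 + ZMod.finEquiv m j, (e i).2.2) := by
    intro l
    simp only [Prod.ext_iff, eq_sub_iff_add_eq]
    exact and_congr eq_comm eq_comm
  rw [Finset.sum_eq_single ((e i).2.1 + ZMod.finEquiv m j, (e i).2.2)]
  · rw [Matrix.mul_apply, Finset.sum_eq_single (j, (e i).2.1 + ZMod.finEquiv m j, (e i).2.2)]
    · have := stdAddChar_div_sqrt_mul_star ((e i).1 * ZMod.finEquiv m j)
        ((e i).1 * ZMod.finEquiv m j)
      rw [sub_self, AddChar.map_zero_eq_one] at this
      simp only [Matrix.conjTranspose_apply, entangledBasis, Matrix.kronecker_apply,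
        Matrix.one_apply_eq, mul_one, add_sub_cancel_right, Prod.mk.eta, if_true, Matrix.diag_apply]
      linear_combination A j j * this
    · rintro ⟨j', l⟩ _ hne
      by_cases h : ((e i).2.1 + ZMod.finEquiv m j, (e i).2.2) = l
      · subst h
        have hj : ZMod.finEquiv m j ≠ ZMod.finEquiv m j' := by
          intro h
          exact hne (by rw [(ZMod.finEquiv m).injective h])
        have : (e i).2 ≠ ((e i).2.1 + ZMod.finEquiv m j - ZMod.finEquiv m j', (e i).2.2) := by
          intro h
          apply hj
          have := congrArg Prod.fst h
          linear_combination -this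
        simp [entangledBasis, this]
      · simp [Matrix.one_apply_ne h]
    · simp
  · intro l _ hne
    simp [Matrix.conjTranspose_apply, entangledBasis, (hl l).not.2 hne]
  · simp


/-- For every `n ≥ 1` there is a star-subalgebra of `M_{2^n}(ℂ)`, star-isomorphic
to `M_{2^⌊n/2⌋}(ℂ)`, all of whose elements have constant diagonal `Tr(a)/2^n`; consequently it
is privatised to the unit by the Schur product with the identity (the projection onto the
diagonal). -/
theorem exists_private_algebra_for_diagonal_channel (n : ℕ) (hn : 1 ≤ n) :
    ∃ 𝒜 : NonUnitalStarSubalgebra ℂ (Matrix (Fin (2 ^ n)) (Fin (2 ^ n)) ℂ),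
      Nonempty (𝒜 ≃⋆ₐ[ℂ] Matrix (Fin (2 ^ (n / 2))) (Fin (2 ^ (n / 2))) ℂ) ∧
      (∀ a ∈ 𝒜, ∀ i, a i i = a.trace / (2 ^ n : ℂ)) ∧
      (∀ a ∈ 𝒜,
        (1 : Matrix (Fin (2 ^ n)) (Fin (2 ^ n)) ℂ) ⊙ a
          = (a.trace / (2 ^ n : ℂ)) • (1 : Matrix (Fin (2 ^ n)) (Fin (2 ^ n)) ℂ)) := by
  have : NeZero (2 ^ (n / 2)) := ⟨by positivity⟩
  obtain ⟨e⟩ : Nonempty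
      (Fin (2 ^ n) ≃ ZMod (2 ^ (n / 2)) × ZMod (2 ^ (n / 2)) × Fin (2 ^ (n % 2))) := by
    rw [← Fintype.card_eq]
    simp only [Fintype.card_prod, ZMod.card, Fintype.card_fin, ← pow_add]
    congr 1
    omega
  have : Nonempty (Fin (2 ^ (n % 2))) := ⟨⟨0, by positivity⟩⟩
  set φ := amplificationConj (entangledBasis e) (entangledBasis_mul_conjTranspose e)
  have hφ : Function.Injective φ := amplificationConj_injective _ _
  have hdiag : ∀ a ∈ NonUnitalStarAlgHom.range φ, ∀ i, a i i = a.trace / (2 ^ n : ℂ) := by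
    rintro _ ⟨A, rfl⟩ i
    have h : ∀ i, φ A i i = A.trace / (2 ^ (n / 2) : ℕ) :=
      amplificationConj_entangledBasis_diag e A
    change φ A i i = (φ A).trace / _
    simp [Matrix.trace, h]
  refine ⟨NonUnitalStarAlgHom.range φ, ⟨(StarAlgEquiv.ofInjective' φ hφ).symm⟩, hdiag, ?_⟩
  intro a ha
  ext i j
  by_cases hij : i = j
  · subst hij
    simp [hdiag a ha i]
  · simp [Matrix.one_apply_ne hij]
end

section
/- Let A_1, …, A_p ∈ M_n(ℂ), define Φ(X) = ∑_i A_i X A_i^* and its adjoint Φ†(X) = ∑_i A_i^* X A_i. Let 𝒜 be a star-subalgebra of M_n(ℂ) that is quasiorthogonal to the range of Φ†, i.e., n·Tr(Φ†(x)·a) = Tr(Φ†(x))·Tr(a) for all x ∈ M_n(ℂ) and all a ∈ 𝒜. Then Φ(a) = (Tr(a)/n)·Φ(I) for all a ∈ 𝒜; that is, 𝒜 is privatised by Φ. -/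
open scoped Matrix

/-- The maps `X ↦ ∑ᵢ Aᵢᴴ X Aᵢ` and `X ↦ ∑ᵢ Aᵢ X Aᵢᴴ` are adjoint for the trace pairing. -/
theorem trace_sum_conjTranspose_mul_mul_mul {ι m n R : Type*} [Fintype ι] [Fintype m] [Fintype n]
    [CommSemiring R] [StarRing R] (A : ι → Matrix m n R) (x : Matrix m m R) (y : Matrix n n R) :
    ((∑ i, (A i)ᴴ * x * A i) * y).trace = (x * ∑ i, A i * y * (A i)ᴴ).trace := by
  simp only [Finset.sum_mul, Finset.mul_sum, Matrix.trace_sum]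
  refine Finset.sum_congr rfl fun i _ => ?_
  rw [Matrix.mul_assoc, Matrix.mul_assoc, Matrix.trace_mul_comm]
  simp only [Matrix.mul_assoc]

/-- If a star-subalgebra `𝒜` is quasiorthogonal to the range of the adjoint
channel `Φ†(X) = ∑ᵢ Aᵢᴴ X Aᵢ`, then `𝒜` is privatised by `Φ(X) = ∑ᵢ Aᵢ X Aᵢᴴ`:
`Φ(a) = (Tr(a)/n) Φ(I)` for all `a ∈ 𝒜`. -/
theorem privatised_of_quasiorthogonal_to_range_adjoint (n p : ℕ)
    (A : Fin p → Matrix (Fin n) (Fin n) ℂ)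
    (𝒜 : NonUnitalStarSubalgebra ℂ (Matrix (Fin n) (Fin n) ℂ))
    (hqo : ∀ x : Matrix (Fin n) (Fin n) ℂ, ∀ a ∈ 𝒜,
      (n : ℂ) * ((∑ i, (A i)ᴴ * x * A i) * a).trace
        = (∑ i, (A i)ᴴ * x * A i).trace * a.trace) :
    ∀ a ∈ 𝒜, ∑ i, A i * a * (A i)ᴴ
      = (a.trace / (n : ℂ)) • ∑ i, A i * (1 : Matrix (Fin n) (Fin n) ℂ) * (A i)ᴴ := by
  intro a ha
  rcases Nat.eq_zero_or_pos n with rfl | hn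
  · exact Subsingleton.elim _ _
  have hn0 : (n : ℂ) ≠ 0 := Nat.cast_ne_zero.mpr hn.ne'
  refine Matrix.ext_iff_trace_mul_left.mpr fun x => ?_
  rw [Matrix.mul_smul, Matrix.trace_smul, ← trace_sum_conjTranspose_mul_mul_mul,
    ← trace_sum_conjTranspose_mul_mul_mul, Matrix.mul_one, smul_eq_mul, div_mul_eq_mul_div,
    eq_div_iff hn0, mul_comm, hqo x a ha, mul_comm]
end

section
/- Let A_1, …, A_p ∈ M_n(ℂ) with ∑_i A_i A_i^* = I (so that Φ(X) = ∑_i A_i X A_i^* is unital), and define Φ†(X) = ∑_i A_i^* X A_i. Suppose a ∈ M_n(ℂ) lies in the range of Φ†, and suppose b ∈ M_n(ℂ) satisfies Φ(b) = (Tr(b)/n)·I (b is privatised to the unit by Φ). Then n·Tr(a·b) = Tr(a)·Tr(b). In particular, if 𝒜 is a star-subalgebra contained in the range of Φ† and ℬ is a star-subalgebra privatised to the unit by Φ, then 𝒜 and ℬ are quasiorthogonal. -/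
open scoped Matrix

/-- The trace pairing identity `Tr(Φ†(x) b) = Tr(x Φ(b))`. -/
theorem trace_sum_conjTranspose_mul_mul {m n ι : Type*} [Fintype m] [Fintype n] [Fintype ι]
    (A : ι → Matrix m n ℂ) (x : Matrix m m ℂ) (b : Matrix n n ℂ) :
    ((∑ i, (A i)ᴴ * x * A i) * b).trace = (x * ∑ i, A i * b * (A i)ᴴ).trace := by
  simp only [Matrix.sum_mul, Matrix.mul_sum, Matrix.trace_sum]
  refine Finset.sum_congr rfl fun i _ => ?_
  rw [Matrix.mul_assoc, Matrix.mul_assoc, Matrix.trace_mul_comm]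
  simp only [Matrix.mul_assoc]

/-- For a unital channel `Φ(X) = ∑ᵢ Aᵢ X Aᵢᴴ` with adjoint
`Φ†(X) = ∑ᵢ Aᵢᴴ X Aᵢ`: if `a` lies in the range of `Φ†` and `b` is privatised to the unit by
`Φ`, then `n Tr(a b) = Tr(a) Tr(b)`. In particular, a star-subalgebra contained in the range of
`Φ†` is quasiorthogonal to any star-subalgebra privatised to the unit by `Φ`. -/
theorem range_adjoint_quasiorthogonal_to_private (n p : ℕ)
    (A : Fin p → Matrix (Fin n) (Fin n) ℂ)
    (hunital : ∑ i, A i * (A i)ᴴ = 1) :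
    (∀ a b : Matrix (Fin n) (Fin n) ℂ,
      (∃ x, a = ∑ i, (A i)ᴴ * x * A i) →
      (∑ i, A i * b * (A i)ᴴ = (b.trace / (n : ℂ)) • 1) →
      (n : ℂ) * (a * b).trace = a.trace * b.trace) ∧
    (∀ 𝒜 ℬ : NonUnitalStarSubalgebra ℂ (Matrix (Fin n) (Fin n) ℂ),
      (∀ a ∈ 𝒜, ∃ x, a = ∑ i, (A i)ᴴ * x * A i) →
      (∀ b ∈ ℬ, ∑ i, A i * b * (A i)ᴴ = (b.trace / (n : ℂ)) • 1) →
      ∀ a ∈ 𝒜, ∀ b ∈ ℬ, (n : ℂ) * (a * b).trace = a.trace * b.trace) := by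
  have key : ∀ a b : Matrix (Fin n) (Fin n) ℂ,
      (∃ x, a = ∑ i, (A i)ᴴ * x * A i) →
      (∑ i, A i * b * (A i)ᴴ = (b.trace / (n : ℂ)) • 1) →
      (n : ℂ) * (a * b).trace = a.trace * b.trace := by
    rintro a b ⟨x, rfl⟩ hb
    have htrace : (∑ i, (A i)ᴴ * x * A i).trace = x.trace := by
      simpa [hunital] using trace_sum_conjTranspose_mul_mul A x 1
    rw [trace_sum_conjTranspose_mul_mul, hb, htrace]
    rcases Nat.eq_zero_or_pos n with rfl | hn
    · simp [Matrix.trace]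
    · have hn' : (n : ℂ) ≠ 0 := by exact_mod_cast hn.ne'
      rw [Matrix.mul_smul, Matrix.mul_one, Matrix.trace_smul, smul_eq_mul]
      field_simp
  exact ⟨key, fun 𝒜 ℬ h𝒜 hℬ a ha b hb => key a b (h𝒜 a ha) (hℬ b hb)⟩
end

section
/- Let C ∈ M_n(ℂ) be a correlation matrix and let 𝒜 be a star-subalgebra of M_n(ℂ) that is privatised to the unit by the Schur product channel Φ(X) = C ∘ X, i.e., C ∘ a = (Tr(a)/n)·I for all a ∈ 𝒜. Then 𝒜 admits a separating vector: there exists v ∈ ℂ^n such that for every a ∈ 𝒜, a·v = 0 implies a = 0. -/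
open scoped Matrix ComplexOrder

/-- A star-subalgebra privatised to the unit by a Schur product channel with a
correlation matrix admits a separating vector. -/
theorem private_algebra_has_separating_vector (n : ℕ) (C : Matrix (Fin n) (Fin n) ℂ)
    (hC : C.PosSemidef) (hCdiag : ∀ i, C i i = 1)
    (𝒜 : NonUnitalStarSubalgebra ℂ (Matrix (Fin n) (Fin n) ℂ))
    (hpriv : ∀ a ∈ 𝒜, C ⊙ a = (a.trace / (n : ℂ)) • 1) :
    ∃ v : Fin n → ℂ, ∀ a ∈ 𝒜, a *ᵥ v = 0 → a = 0 := by
  rcases n with _ | n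
  · exact ⟨0, fun a _ _ => Subsingleton.elim _ _⟩
  refine ⟨Pi.single 0 1, fun a ha hav => ?_⟩
  have hmem : aᴴ * a ∈ 𝒜 := mul_mem (star_mem ha) ha
  have hentry : (aᴴ * a) 0 0 = 0 := by
    have hcol : ∀ i, a i 0 = 0 := fun i => by simpa using congrFun hav i
    simp [Matrix.mul_apply, hcol]
  have htrace : (aᴴ * a).trace = 0 := by
    have h := congrFun (congrFun (hpriv _ hmem) 0) 0
    rw [Matrix.hadamard_apply, hCdiag, one_mul, hentry, Matrix.smul_apply,
      Matrix.one_apply_eq, smul_eq_mul, mul_one, eq_comm, div_eq_zero_iff] at h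
    exact h.resolve_right (Nat.cast_ne_zero.mpr n.succ_ne_zero)
  exact Matrix.trace_conjTranspose_mul_self_eq_zero_iff.mp htrace
end

section
/- Let C ∈ M_n(ℂ) be a correlation matrix with graph G_C, and let b ∈ M_n(ℂ) be quasiorthogonal to the algebra generated by the operator system of G_C, in the sense that n·Tr(b·x) = Tr(b)·Tr(x) for every matrix x ∈ M_n(ℂ) satisfying x_{ij} = 0 whenever i and j lie in different connected components of G_C. Then C ∘ b = (Tr(b)/n)·I; that is, b is privatised to the unit by the Schur product channel Φ(X) = C ∘ X. -/
open scoped Matrix ComplexOrder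

/-- If `b` is quasiorthogonal to the algebra generated by the operator system of
the graph of a correlation matrix `C` (the matrices supported on pairs of indices lying in the
same connected component of `G_C`), then `b` is privatised to the unit by the Schur product
channel `Φ(X) = C ∘ X`. -/
theorem quasiorthogonal_to_component_algebra_implies_private (n : ℕ)
    (C : Matrix (Fin n) (Fin n) ℂ)
    (hC : C.PosSemidef) (hCdiag : ∀ i, C i i = 1)
    (G : SimpleGraph (Fin n)) (hG : ∀ i j, G.Adj i j ↔ i ≠ j ∧ C i j ≠ 0)
    (b : Matrix (Fin n) (Fin n) ℂ)
    (hqo : ∀ x : Matrix (Fin n) (Fin n) ℂ,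
      (∀ i j, ¬ G.Reachable i j → x i j = 0) →
      (n : ℂ) * (b * x).trace = b.trace * x.trace) :
    C ⊙ b = (b.trace / (n : ℂ)) • 1 := by
  ext i j
  have hn : (n : ℂ) ≠ 0 := Nat.cast_ne_zero.mpr i.pos.ne'
  have entry (hr : G.Reachable j i) :
      (n : ℂ) * b i j = b.trace * (Matrix.single j i (1 : ℂ)).trace := by
    have h := hqo (Matrix.single j i 1) fun k l hkl ↦
      Matrix.single_apply_of_ne _ _ _ _ _ (by rintro ⟨rfl, rfl⟩; exact hkl hr)
    rwa [Matrix.trace_mul_single, MulOpposite.op_one, one_smul] at h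
  rw [Matrix.hadamard_apply, Matrix.smul_apply, smul_eq_mul]
  by_cases hij : i = j
  · subst hij
    have h := entry (SimpleGraph.Reachable.refl i)
    rw [Matrix.trace_single_eq_same, mul_one] at h
    rw [hCdiag, one_mul, Matrix.one_apply_eq, mul_one, eq_div_iff hn, mul_comm, h]
  · rw [Matrix.one_apply_ne hij, mul_zero]
    by_cases hc : C i j = 0
    · rw [hc, zero_mul]
    · have h := entry ((hG i j).mpr ⟨hij, hc⟩).symm.reachable
      rw [Matrix.trace_single_eq_of_ne _ _ _ (Ne.symm hij), mul_zero] at h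
      rw [(mul_eq_zero.mp h).resolve_left hn, mul_zero]
end
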